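/- (Theorem 1, finite-dimensional constructive form.) Let ε ≥ 0 and let ρ₀, ρ₁ be density matrices on ℂⁿ with trace distance D(ρ₀,ρ₁) ≤ ε. Let ψ₀, ψ₁ ∈ ℂⁿ ⊗ ℂⁿ be any purifications of ρ₀ and ρ₁ respectively (unit vectors whose reduced states on the second tensor factor are ρ₀ and ρ₁). Then there exists a unitary n×n complex matrix U acting on the first factor only such that, with ψ₁♯ = (U ⊗ I) ψ₀, the trace distance satisfies D(ψ₁♯(ψ₁♯)ᴴ, ψ₁ψ₁ᴴ) ≤ √(2ε). -/

import Mathlib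

open Matrix Complex Finset
open scoped ComplexOrder

/-- The trace norm `‖A‖₁ = Tr √(Aᴴ A)`. -/
noncomputable def traceNorm {ι : Type*} [Fintype ι] [DecidableEq ι]
    (A : Matrix ι ι ℂ) : ℝ :=
  (((Matrix.posSemidef_conjTranspose_mul_self A).1.cfc Real.sqrt).trace).re

/-- The trace distance `D(ρ,σ) = ½‖ρ − σ‖₁`. -/
noncomputable def traceDist {ι : Type*} [Fintype ι] [DecidableEq ι]
    (ρ σ : Matrix ι ι ℂ) : ℝ :=
  traceNorm (ρ - σ) / 2

/-- The rank-one matrix `ψψᴴ` associated with a vector `ψ ∈ ℂᵐ ⊗ ℂⁿ`. -/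
noncomputable def pureState {m n : ℕ} (ψ : Fin m → Fin n → ℂ) :
    Matrix (Fin m × Fin n) (Fin m × Fin n) ℂ :=
  Matrix.of fun ab cd => ψ ab.1 ab.2 * star (ψ cd.1 cd.2)

open scoped MatrixOrder

theorem star_dotProduct_star_entries {ι : Type*} [Fintype ι] (X Y : Matrix ι ι ℂ) :
    star (fun p : ι × ι => star (X p.1 p.2)) ⬝ᵥ (fun p : ι × ι => star (Y p.1 p.2)) =
      (X * Yᴴ).trace := by
  simp [dotProduct, Matrix.trace, Matrix.mul_apply, Fintype.sum_prod_type]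

section TraceNorm

variable {ι : Type*} [Fintype ι] [DecidableEq ι]

/-- Two matrices with the same Gram matrix differ by a unitary factor on the left. -/
theorem exists_mem_unitaryGroup_mul_eq {A B : Matrix ι ι ℂ} (h : Aᴴ * A = Bᴴ * B) :
    ∃ V ∈ Matrix.unitaryGroup ι ℂ, V * B = A := by
  let T := Matrix.toEuclideanCLM (n := ι) (𝕜 := ℂ)
  have hT : ∀ (C : Matrix ι ι ℂ) x, ‖T C x‖ ^ 2 = (inner ℂ x (T (Cᴴ * C) x)).re := by
    intro C x
    rw [← Matrix.star_eq_conjTranspose, map_mul, map_star, ContinuousLinearMap.star_eq_adjoint,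
      mul_apply_eq_comp, ContinuousLinearMap.adjoint_inner_right]
    exact (inner_self_eq_norm_sq (𝕜 := ℂ) _).symm
  have hnorm : ∀ x, ‖T A x‖ = ‖T B x‖ := fun x => by
    rw [← sq_eq_sq₀ (norm_nonneg _) (norm_nonneg _), hT, hT, h]
  let g := (T B).toLinearMap
  obtain ⟨s, hs⟩ := g.rangeRestrict.exists_rightInverse_of_surjective g.range_rangeRestrict
  have hs' : ∀ y, T B (s y) = y := fun y => congrArg Subtype.val (LinearMap.congr_fun hs y)
  let L : LinearMap.range g →ₗᵢ[ℂ] EuclideanSpace ℂ ι :=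
    ⟨(T A).toLinearMap ∘ₗ s, fun y => by
      change ‖T A (s y)‖ = ‖(y : EuclideanSpace ℂ ι)‖
      rw [hnorm, hs']⟩
  let W := L.extend.toContinuousLinearMap
  have hW : ∀ x, W (T B x) = T A x := by
    intro x
    have h1 : W (T B x) = T A (s (g.rangeRestrict x)) := L.extend_apply (g.rangeRestrict x)
    have h2 : T B (s (g.rangeRestrict x)) = T B x := hs' _
    rw [h1, ← sub_eq_zero, ← map_sub, ← norm_eq_zero, hnorm, map_sub, h2, sub_self, norm_zero]
  refine ⟨T.symm W, Matrix.mem_unitaryGroup_iff'.2 (EquivLike.injective T ?_), EquivLike.injective T ?_⟩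
  · rw [map_mul, map_star, T.apply_symm_apply, map_one, ContinuousLinearMap.star_eq_adjoint]
    exact (ContinuousLinearMap.norm_map_iff_adjoint_comp_self W).1 L.extend.norm_map
  · rw [map_mul, T.apply_symm_apply]
    exact ContinuousLinearMap.ext hW

theorem traceNorm_eq_trace_abs (A : Matrix ι ι ℂ) : traceNorm A = (CFC.abs A).trace.re := by
  have hA := Matrix.posSemidef_conjTranspose_mul_self A
  have hA' : 0 ≤ star A * A := hA.nonneg
  rw [traceNorm, CFC.abs, CFC.sqrt_eq_real_sqrt (star A * A) hA', cfcₙ_eq_cfc,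
    Matrix.star_eq_conjTranspose, hA.1.cfc_eq]

theorem traceNorm_eq_sum_sqrt (A : Matrix ι ι ℂ) :
    traceNorm A =
      ∑ i, Real.sqrt ((Matrix.posSemidef_conjTranspose_mul_self A).1.eigenvalues i) := by
  rw [traceNorm, Matrix.IsHermitian.cfc, Unitary.conjStarAlgAut_apply, Matrix.trace_mul_cycle]
  simp [Matrix.trace]

/-- Cauchy–Schwarz: the trace norm is at most `√rank` times the Hilbert–Schmidt norm. -/
theorem traceNorm_sq_le_rank_mul (A : Matrix ι ι ℂ) :
    traceNorm A ^ 2 ≤ A.rank * (Aᴴ * A).trace.re := by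
  have hA := Matrix.posSemidef_conjTranspose_mul_self A
  have hrank : A.rank = (univ.filter fun i => hA.1.eigenvalues i ≠ 0).card := by
    rw [← Matrix.rank_conjTranspose_mul_self, hA.1.rank_eq_card_non_zero_eigs,
      Fintype.card_subtype]
  have htr : (Aᴴ * A).trace.re = ∑ i, hA.1.eigenvalues i := by
    rw [hA.1.trace_eq_sum_eigenvalues]
    simp
  have hsum : traceNorm A =
      ∑ i ∈ univ.filter fun i => hA.1.eigenvalues i ≠ 0, Real.sqrt (hA.1.eigenvalues i) := by
    rw [traceNorm_eq_sum_sqrt, Finset.sum_filter_of_ne]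
    intro i _ hi h0
    exact hi (by rw [h0, Real.sqrt_zero])
  rw [hsum, hrank, htr]
  refine (sq_sum_le_card_mul_sum_sq).trans ?_
  gcongr
  simp_rw [Real.sq_sqrt (hA.eigenvalues_nonneg _)]
  exact Finset.sum_le_univ_sum_of_nonneg hA.eigenvalues_nonneg

/-- The Powers–Størmer inequality. -/
theorem trace_sub_mul_sub_le_traceNorm {S T : Matrix ι ι ℂ} (hS : S.PosSemidef)
    (hT : T.PosSemidef) :
    ((S - T) * (S - T)).trace.re ≤ traceNorm (S * S - T * T) := by
  have hD : (S - T).IsHermitian := hS.1.sub hT.1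
  have hM : IsSelfAdjoint (S * S - T * T) := by
    rw [← sq, ← sq]
    exact (IsSelfAdjoint.pow hS.1 2).sub (IsSelfAdjoint.pow hT.1 2)
  let c := Unitary.conjStarAlgAut ℂ (Matrix ι ι ℂ) (star hD.eigenvectorUnitary)
  have hc : c (S - T) = Matrix.diagonal (Complex.ofReal ∘ hD.eigenvalues) :=
    hD.conjStarAlgAut_star_eigenvectorUnitary
  have htr : ∀ X, (c X).trace = X.trace := fun X => by
    rw [Unitary.conjStarAlgAut_star_apply, Matrix.trace_mul_cycle]
    simp
  have hpos : ∀ X : Matrix ι ι ℂ, 0 ≤ X → ∀ i, 0 ≤ (c X i i).re := fun X hX i => by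
    have h : (c X).PosSemidef := by
      rw [Unitary.conjStarAlgAut_star_apply]
      exact hX.posSemidef.conjTranspose_mul_mul_same _
    exact (Complex.le_def.1 (h.diag_nonneg (i := i))).1
  rw [traceNorm_eq_trace_abs, ← htr, ← htr (CFC.abs _), map_mul, hc, Matrix.diagonal_mul_diagonal,
    Matrix.trace, Matrix.trace, Complex.re_sum, Complex.re_sum]
  refine Finset.sum_le_sum fun i _ => ?_
  set K := CFC.abs (S * S - T * T)
  have hST : (c S i i).re - (c T i i).re = hD.eigenvalues i := by
    have := congrArg (fun X : Matrix ι ι ℂ => (X i i).re) hc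
    simpa using this
  have hMi : (c (S * S - T * T) i i).re =
      hD.eigenvalues i * ((c S i i).re + (c T i i).re) := by
    have h2 : (2 : ℂ) • (S * S - T * T) = (S - T) * (S + T) + (S + T) * (S - T) := by
      rw [two_smul]; noncomm_ring
    have h3 := congrArg (fun X : Matrix ι ι ℂ => (X i i).re) (congrArg c h2)
    simp only [map_smul, map_add, map_mul, hc, Matrix.add_apply, Matrix.diagonal_mul,
      Matrix.mul_diagonal, Matrix.smul_apply] at h3
    simp at h3
    simp
    linarith
  have hplus : 0 ≤ (c K i i).re + (c (S * S - T * T) i i).re := by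
    have h : 0 ≤ K + (S * S - T * T) := by
      rw [CFC.abs_add_self _ hM]
      exact nsmul_nonneg (CFC.posPart_nonneg _) 2
    simpa only [map_add, Matrix.add_apply, Complex.add_re] using hpos _ h i
  have hminus : 0 ≤ (c K i i).re - (c (S * S - T * T) i i).re := by
    have h : 0 ≤ K - (S * S - T * T) := by
      rw [CFC.abs_sub_self _ hM]
      exact nsmul_nonneg (CFC.negPart_nonneg _) 2
    simpa only [map_sub, Matrix.sub_apply, Complex.sub_re] using hpos _ h i
  have hSi := hpos S hS.nonneg i
  have hTi := hpos T hT.nonneg i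
  simp only [Matrix.diag_apply, Matrix.diagonal_apply_eq, Function.comp_apply,
    ← Complex.ofReal_mul, Complex.ofReal_re]
  rw [hMi] at hplus hminus
  rcases le_total 0 (hD.eigenvalues i) with h0 | h0
  · nlinarith [mul_nonneg h0 hTi]
  · nlinarith [mul_nonneg (neg_nonneg.2 h0) hSi]

/-- The trace norm of a difference of pure states with real overlap `⟨v, u⟩ = F`. -/
theorem traceNorm_vecMulVec_sub_le {u v : ι → ℂ} (hu : star u ⬝ᵥ u = 1) (hv : star v ⬝ᵥ v = 1)
    {F : ℝ} (hF : star v ⬝ᵥ u = F) :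
    traceNorm (Matrix.vecMulVec u (star u) - Matrix.vecMulVec v (star v)) ^ 2 ≤
      4 * (1 - F ^ 2) := by
  have hF' : star u ⬝ᵥ v = F := by
    rw [Matrix.star_dotProduct, hF]
    simp
  set M := Matrix.vecMulVec u (star u) - Matrix.vecMulVec v (star v) with hM
  have hrank : M.rank ≤ 2 := by
    have h : M = (Matrix.of ![u, v])ᵀ * Matrix.of ![star u, -star v] := by
      ext i j
      simp [hM, Matrix.mul_apply, Matrix.vecMulVec_apply, sub_eq_add_neg]
    rw [h]
    refine (Matrix.rank_mul_le_left _ _).trans ?_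
    simpa using Matrix.rank_le_card_width (Matrix.of ![u, v])ᵀ
  have htr : (Mᴴ * M).trace = 2 * (1 - (F : ℂ) ^ 2) := by
    simp only [hM, Matrix.conjTranspose_sub, Matrix.conjTranspose_vecMulVec, star_star,
      Matrix.sub_mul, Matrix.mul_sub, Matrix.vecMulVec_mul_vecMulVec, Matrix.trace_sub,
      Matrix.trace_smul, Matrix.trace_vecMulVec, hu, hv, hF, hF', dotProduct_comm u,
      dotProduct_comm v, Matrix.vecMulVec_smul, smul_eq_mul]
    ring
  have hre : (Mᴴ * M).trace.re = 2 * (1 - F ^ 2) := by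
    rw [htr]
    norm_cast
  have hnn : 0 ≤ (Mᴴ * M).trace.re :=
    (Complex.le_def.1 (Matrix.posSemidef_conjTranspose_mul_self M).trace_nonneg).1
  have hrank' : (M.rank : ℝ) ≤ 2 := by exact_mod_cast hrank
  calc traceNorm M ^ 2 ≤ M.rank * (Mᴴ * M).trace.re := traceNorm_sq_le_rank_mul M
    _ ≤ 2 * (Mᴴ * M).trace.re := by gcongr
    _ = 4 * (1 - F ^ 2) := by rw [hre]; ring

theorem trace_unitary_mul_mul_conjTranspose {V : Matrix ι ι ℂ}
    (hV : V ∈ Matrix.unitaryGroup ι ℂ) (X Y : Matrix ι ι ℂ) :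
    ((V * X) * (V * Y)ᴴ).trace = (X * Yᴴ).trace := by
  rw [Matrix.conjTranspose_mul, Matrix.mul_assoc, Matrix.trace_mul_comm, ← Matrix.mul_assoc,
    Matrix.mul_assoc _ Vᴴ, ← Matrix.star_eq_conjTranspose V, Matrix.mem_unitaryGroup_iff'.1 hV,
    Matrix.mul_one]

/-- A purification of `ρ`, conjugated entrywise, is a unitary times `√ρ`. -/
theorem exists_mem_unitaryGroup_mul_sqrt_eq {ρ : Matrix ι ι ℂ} (hρ : ρ.PosSemidef)
    {ψ : ι → ι → ℂ} (h : ∀ j j', ∑ i, ψ i j * star (ψ i j') = ρ j j') :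
    ∃ V ∈ Matrix.unitaryGroup ι ℂ, V * CFC.sqrt ρ = (Matrix.of ψ).map star := by
  apply exists_mem_unitaryGroup_mul_eq
  rw [(CFC.sqrt_nonneg ρ).posSemidef.1.eq, CFC.sqrt_mul_sqrt_self ρ hρ.nonneg]
  ext j j'
  simp [Matrix.mul_apply, ← h]

end TraceNorm

/-- Theorem 1, finite-dimensional constructive form. If
`D(ρ₀,ρ₁) ≤ ε`, then for any purifications `ψ₀` of `ρ₀` and `ψ₁` of `ρ₁` there is a
unitary `U` acting on the first factor only such that, with `ψ₁♯ = (U ⊗ I) ψ₀`,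
`D(ψ₁♯(ψ₁♯)ᴴ, ψ₁ψ₁ᴴ) ≤ √(2ε)`. -/
theorem exists_cheating_unitary
    {n : ℕ} (ε : ℝ) (hε : 0 ≤ ε)
    (ρ₀ ρ₁ : Matrix (Fin n) (Fin n) ℂ)
    (hρ₀ : ρ₀.PosSemidef) (hρ₁ : ρ₁.PosSemidef)
    (hτ₀ : ρ₀.trace = 1) (hτ₁ : ρ₁.trace = 1)
    (hD : traceDist ρ₀ ρ₁ ≤ ε)
    (ψ₀ ψ₁ : Fin n → Fin n → ℂ)
    (hψ₀u : ∑ i, ∑ j, star (ψ₀ i j) * ψ₀ i j = 1)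
    (hψ₁u : ∑ i, ∑ j, star (ψ₁ i j) * ψ₁ i j = 1)
    (hψ₀red : ∀ j j', (∑ i, ψ₀ i j * star (ψ₀ i j')) = ρ₀ j j')
    (hψ₁red : ∀ j j', (∑ i, ψ₁ i j * star (ψ₁ i j')) = ρ₁ j j') :
    ∃ U ∈ Matrix.unitaryGroup (Fin n) ℂ,
      traceDist (pureState fun i j => ∑ k, U i k * ψ₀ k j) (pureState ψ₁)
        ≤ Real.sqrt (2 * ε) := by
  obtain ⟨V₀, hV₀, h₀⟩ := exists_mem_unitaryGroup_mul_sqrt_eq hρ₀ hψ₀red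
  obtain ⟨V₁, hV₁, h₁⟩ := exists_mem_unitaryGroup_mul_sqrt_eq hρ₁ hψ₁red
  have hS₀ := (CFC.sqrt_nonneg ρ₀).posSemidef
  have hS₁ := (CFC.sqrt_nonneg ρ₁).posSemidef
  have hsq₀ := CFC.sqrt_mul_sqrt_self ρ₀ hρ₀.nonneg
  have hsq₁ := CFC.sqrt_mul_sqrt_self ρ₁ hρ₁.nonneg
  set S₀ := CFC.sqrt ρ₀
  set S₁ := CFC.sqrt ρ₁
  let W : Matrix.unitaryGroup (Fin n) ℂ := ⟨V₁, hV₁⟩ * star ⟨V₀, hV₀⟩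
  have hW : (W : Matrix (Fin n) (Fin n) ℂ) * (Matrix.of ψ₀).map star = V₁ * S₀ := by
    change V₁ * star V₀ * _ = _
    rw [← h₀, Matrix.mul_assoc, ← Matrix.mul_assoc (star V₀),
      Matrix.mem_unitaryGroup_iff'.1 hV₀, Matrix.one_mul]
  refine ⟨(W : Matrix (Fin n) (Fin n) ℂ).map star, ?_, ?_⟩
  · exact Matrix.map_star_mem_unitaryGroup_iff.2 W.2
  set F : ℝ := (S₀ * S₁).trace.re
  have hF : (S₁ * S₀).trace = F := by
    rw [Matrix.trace_mul_comm]
    refine (Complex.conj_eq_iff_re.1 ?_).symm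
    rw [starRingEnd_apply, ← Matrix.trace_conjTranspose, Matrix.conjTranspose_mul, hS₀.1.eq,
      hS₁.1.eq, Matrix.trace_mul_comm]
  let u : Fin n × Fin n → ℂ := fun p => star ((V₁ * S₀) p.1 p.2)
  let v : Fin n × Fin n → ℂ := fun p => star ((V₁ * S₁) p.1 p.2)
  have hu : pureState (fun i j => ∑ k, (W : Matrix (Fin n) (Fin n) ℂ).map star i k * ψ₀ k j) =
      Matrix.vecMulVec u (star u) := by
    have h : ∀ i j, ∑ k, (W : Matrix (Fin n) (Fin n) ℂ).map star i k * ψ₀ k j = u (i, j) := by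
      intro i j
      change _ = star ((V₁ * S₀) i j)
      rw [← hW]
      simp [Matrix.mul_apply]
    ext p q
    simp only [pureState, h, Matrix.vecMulVec_apply, Matrix.of_apply, Pi.star_apply]
  have hv : pureState ψ₁ = Matrix.vecMulVec v (star v) := by
    ext p q
    simp [pureState, v, h₁, Matrix.vecMulVec_apply]
  have hinner : ∀ X Y : Matrix (Fin n) (Fin n) ℂ, Y.IsHermitian →
      star (fun p : Fin n × Fin n => star ((V₁ * X) p.1 p.2)) ⬝ᵥ
        (fun p : Fin n × Fin n => star ((V₁ * Y) p.1 p.2)) = (X * Y).trace := fun X Y hY => by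
    rw [star_dotProduct_star_entries, trace_unitary_mul_mul_conjTranspose hV₁, hY.eq]
  have hpure := traceNorm_vecMulVec_sub_le (u := u) (v := v)
    (by rw [hinner _ _ hS₀.1, hsq₀, hτ₀]) (by rw [hinner _ _ hS₁.1, hsq₁, hτ₁])
    ((hinner _ _ hS₀.1).trans hF)
  have hPS := trace_sub_mul_sub_le_traceNorm hS₀ hS₁
  have hexpand : ((S₀ - S₁) * (S₀ - S₁)).trace.re = 2 - 2 * F := by
    have h : ((S₀ - S₁) * (S₀ - S₁)).trace = ((2 - 2 * F : ℝ) : ℂ) := by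
      rw [Matrix.sub_mul, Matrix.mul_sub, Matrix.mul_sub, Matrix.trace_sub, Matrix.trace_sub,
        Matrix.trace_sub, hsq₀, hsq₁, hτ₀, hτ₁, Matrix.trace_mul_comm S₀, hF]
      push_cast
      ring
    rw [h, Complex.ofReal_re]
  rw [hexpand, hsq₀, hsq₁] at hPS
  rw [traceDist] at hD ⊢
  rw [hu, hv]
  apply Real.le_sqrt_of_sq_le
  nlinarith [sq_nonneg (1 - F)]
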